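/- For every permutation w of [n+1], one has in R_n the identity (∏_{i an ascent of w} τ_{w[i]})·(∏_{i a descent of w} τ_{w[i]}) = τ_{{1}}·τ_{{1,2}}⋯τ_{{1,…,n}}. (Geometrically: the subvarieties Y^w and X_w intersect transversally in a single point, so ⟨[Y^w][X_w], μ_X⟩ = 1.) -/

import Mathlib

open MvPolynomial

/-- Index type: nonempty proper subsets of `[n+1]` (realized as `Fin (n+1)`). -/
abbrev IdxA (n : ℕ) := {S : Finset (Fin (n + 1)) // S.Nonempty ∧ S ≠ Finset.univ}

/-- Generators of the defining ideal of `R_n`: (i) products `τ_S τ_T` for incomparable `S, T`;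
(ii) the linear relations `Σ_{k∈S, l∉S} τ_S − Σ_{k∉S, l∈S} τ_S` for `k, l ∈ [n+1]`. -/
def relA (n : ℕ) : Set (MvPolynomial (IdxA n) ℤ) :=
  {p | ∃ S T : IdxA n, ¬ S.1 ⊆ T.1 ∧ ¬ T.1 ⊆ S.1 ∧ p = X S * X T} ∪
  {p | ∃ k l : Fin (n + 1), p =
      (∑ S : IdxA n, if k ∈ S.1 ∧ l ∉ S.1 then X S else 0) -
      (∑ S : IdxA n, if k ∉ S.1 ∧ l ∈ S.1 then X S else 0)}

/-- The ring `R_n`. -/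
abbrev RA (n : ℕ) := MvPolynomial (IdxA n) ℤ ⧸ Ideal.span (relA n)

/-- The class `τ_S ∈ R_n`, with the convention `τ_∅ = τ_{[n+1]} = 1`. -/
noncomputable def tauA (n : ℕ) (S : Finset (Fin (n + 1))) : RA n :=
  if h : S.Nonempty ∧ S ≠ Finset.univ then Ideal.Quotient.mk _ (X (⟨S, h⟩ : IdxA n)) else 1

/-- The value `w(i) ∈ {1,…,n+1}` of the permutation `w` at the (1-indexed) position `i`. -/
def pval (n : ℕ) (u : Equiv.Perm (Fin (n + 1))) (i : ℕ) : ℕ :=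
  if h : i - 1 < n + 1 then (u ⟨i - 1, h⟩ : ℕ) + 1 else 0

/-- The set of descents of `u`: those `i ∈ [n]` with `u(i) > u(i+1)`. -/
def descents (n : ℕ) (u : Equiv.Perm (Fin (n + 1))) : Finset ℕ :=
  (Finset.Icc 1 n).filter (fun i => pval n u (i + 1) < pval n u i)

/-- The set of ascents of `u`: those `i ∈ [n]` which are not descents. -/
def ascents (n : ℕ) (u : Equiv.Perm (Fin (n + 1))) : Finset ℕ :=
  (Finset.Icc 1 n).filter (fun i => ¬ pval n u (i + 1) < pval n u i)

/-- The subset `u[i] = {u(1),…,u(i)}` of `[n+1]`. -/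
def pSet (n : ℕ) (u : Equiv.Perm (Fin (n + 1))) (i : ℕ) : Finset (Fin (n + 1)) :=
  (Finset.univ.filter (fun k : Fin (n + 1) => (k : ℕ) < i)).image (fun k => u k)

lemma tauA_coe (n : ℕ) (S : IdxA n) :
    tauA n S.1 = Ideal.Quotient.mk (Ideal.span (relA n)) (X S) := by
  rw [tauA, dif_pos S.2]

/-- The classes of two incomparable subsets multiply to zero. -/
lemma tauA_mul_eq_zero (n : ℕ) {S T : Finset (Fin (n + 1))} (hST : ¬ S ⊆ T) (hTS : ¬ T ⊆ S) :
    tauA n S * tauA n T = 0 := by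
  have hS : S.Nonempty ∧ S ≠ Finset.univ := by
    refine ⟨Finset.nonempty_iff_ne_empty.2 ?_, ?_⟩ <;> rintro rfl <;> simp at hST hTS
  have hT : T.Nonempty ∧ T ≠ Finset.univ := by
    refine ⟨Finset.nonempty_iff_ne_empty.2 ?_, ?_⟩ <;> rintro rfl <;> simp at hST hTS
  rw [tauA_coe n ⟨S, hS⟩, tauA_coe n ⟨T, hT⟩, ← map_mul]
  exact Ideal.Quotient.eq_zero_iff_mem.2
    (Ideal.subset_span (Or.inl ⟨⟨S, hS⟩, ⟨T, hT⟩, hST, hTS, rfl⟩))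

/-- The linear relations, as an equality of sums of classes. -/
lemma sum_tauA_eq (n : ℕ) (k l : Fin (n + 1)) :
    (∑ S : IdxA n, if k ∈ S.1 ∧ l ∉ S.1 then tauA n S.1 else 0) =
      ∑ S : IdxA n, if l ∈ S.1 ∧ k ∉ S.1 then tauA n S.1 else 0 := by
  have h := Ideal.Quotient.eq_zero_iff_mem.2 (Ideal.subset_span (s := relA n) (Or.inr ⟨k, l, rfl⟩))
  rw [map_sub, sub_eq_zero, map_sum, map_sum] at h
  simpa only [apply_ite (Ideal.Quotient.mk (Ideal.span (relA n))), map_zero, ← tauA_coe,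
    and_comm (a := k ∉ _)] using h

/-- Multiplying by the classes of `A` and `A ∪ {a, b}` singles out the class of `A ∪ {a}` among the
classes of the subsets containing `a` but not `b`. -/
lemma tauA_mul_sum (n : ℕ) {A : Finset (Fin (n + 1))} {a b : Fin (n + 1)} (ha : a ∉ A) (hb : b ∉ A)
    (hab : a ≠ b) :
    tauA n A * tauA n (insert b (insert a A)) *
        (∑ S : IdxA n, if a ∈ S.1 ∧ b ∉ S.1 then tauA n S.1 else 0) =
      tauA n A * tauA n (insert b (insert a A)) * tauA n (insert a A) := by
  have hbA : b ∉ insert a A := by simp [hab.symm, hb]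
  have hI : (insert a A).Nonempty ∧ insert a A ≠ Finset.univ :=
    ⟨Finset.insert_nonempty _ _, fun h => hbA (h ▸ Finset.mem_univ b)⟩
  rw [Finset.mul_sum, Finset.sum_eq_single (⟨insert a A, hI⟩ : IdxA n)]
  · rw [if_pos ⟨Finset.mem_insert_self _ _, hbA⟩]
  · rintro S - hS
    split_ifs with h
    · by_cases hAS : A ⊆ S.1
      · have hSB : ¬ S.1 ⊆ insert b (insert a A) := fun hSB =>
          hS (Subtype.ext (((Finset.subset_insert_iff_of_notMem h.2).1 hSB).antisymm
            (Finset.insert_subset h.1 hAS)))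
        have hBS : ¬ insert b (insert a A) ⊆ S.1 := fun hBS =>
          h.2 (hBS (Finset.mem_insert_self _ _))
        rw [mul_assoc, tauA_mul_eq_zero n hBS hSB, mul_zero]
      · rw [mul_right_comm, tauA_mul_eq_zero n hAS fun hSA => ha (hSA h.1), zero_mul]
    · exact mul_zero _
  · simp

lemma tauA_insert_exchange (n : ℕ) {A : Finset (Fin (n + 1))} {a b : Fin (n + 1)} (ha : a ∉ A)
    (hb : b ∉ A) (hab : a ≠ b) :
    tauA n A * tauA n (insert b (insert a A)) * tauA n (insert a A) =
      tauA n A * tauA n (insert b (insert a A)) * tauA n (insert b A) := by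
  rw [← tauA_mul_sum n ha hb hab, sum_tauA_eq, Finset.insert_comm b a A,
    tauA_mul_sum n hb ha hab.symm]

lemma mem_pSet (n : ℕ) (u : Equiv.Perm (Fin (n + 1))) (i : ℕ) (x : Fin (n + 1)) :
    x ∈ pSet n u i ↔ (u.symm x : ℕ) < i := by
  simp only [pSet, Finset.mem_image, Finset.mem_filter, Finset.mem_univ, true_and]
  exact ⟨by rintro ⟨k, hk, rfl⟩; simpa using hk, fun h => ⟨_, h, u.apply_symm_apply x⟩⟩

lemma pSet_succ (n : ℕ) (u : Equiv.Perm (Fin (n + 1))) (i : Fin (n + 1)) :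
    pSet n u (i + 1) = insert (u i) (pSet n u i) := by
  ext x
  rw [Finset.mem_insert, mem_pSet, mem_pSet, ← Equiv.symm_apply_eq, Fin.ext_iff]
  omega

lemma pSet_mul_swap (n : ℕ) (u : Equiv.Perm (Fin (n + 1))) (i : Fin n) {j : ℕ}
    (hj : j ≠ i + 1) :
    pSet n (u * Equiv.swap i.castSucc i.succ) j = pSet n u j := by
  ext x
  rw [mem_pSet, mem_pSet]
  change ((Equiv.swap i.castSucc i.succ (u.symm x) : Fin (n + 1)) : ℕ) < j ↔ _
  rw [Equiv.swap_apply_def]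
  split_ifs with h h
  · rw [h, Fin.val_succ, Fin.val_castSucc]; omega
  · rw [h, Fin.val_succ, Fin.val_castSucc]; omega
  · rfl

/-- The product of the classes in a complete flag may be extended by the trivial steps. -/
lemma prod_tauA_Icc (n : ℕ) (u : Equiv.Perm (Fin (n + 1))) :
    ∏ i ∈ Finset.Icc 1 n, tauA n (pSet n u i) =
      ∏ i ∈ Finset.range (n + 2), tauA n (pSet n u i) := by
  refine Finset.prod_subset (fun i hi => ?_) fun i hi hi' => ?_
  · simp only [Finset.mem_Icc, Finset.mem_range] at *; omega
  · simp only [Finset.mem_Icc, Finset.mem_range] at hi hi'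
    obtain rfl | rfl : i = 0 ∨ i = n + 1 := by omega
    · exact dif_neg fun h => by
        obtain ⟨x, hx⟩ := h.1
        simp [mem_pSet] at hx
    · exact dif_neg fun h => h.2 (Finset.eq_univ_of_forall fun x =>
        (mem_pSet n u _ x).2 (Fin.is_lt _))

/-- Exchanging two consecutive entries of a permutation does not change its flag monomial. -/
lemma prod_tauA_mul_swap (n : ℕ) (u : Equiv.Perm (Fin (n + 1))) (i : Fin n) :
    ∏ j ∈ Finset.range (n + 2), tauA n (pSet n (u * Equiv.swap i.castSucc i.succ) j) =
      ∏ j ∈ Finset.range (n + 2), tauA n (pSet n u j) := by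
  have hi := i.2
  have hmem : (i + 1 : ℕ) ∈ Finset.range (n + 2) := Finset.mem_range.2 (by omega)
  rw [← Finset.prod_erase_mul _ _ hmem, ← Finset.prod_erase_mul _ _ hmem,
    Finset.prod_congr rfl fun j hj => by rw [pSet_mul_swap n u i (Finset.ne_of_mem_erase hj)]]
  have hsub : ({(i : ℕ), (i : ℕ) + 2} : Finset ℕ) ⊆ (Finset.range (n + 2)).erase (i + 1) := by
    intro j hj
    simp only [Finset.mem_insert, Finset.mem_singleton, Finset.mem_erase, Finset.mem_range] at *
    omega
  rw [← Finset.prod_sdiff hsub, Finset.prod_pair (by omega)]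
  refine (mul_assoc _ _ _).trans ((congrArg _ ?_).trans (mul_assoc _ _ _).symm)
  have h₁ := pSet_succ n u i.castSucc
  have h₂ := pSet_succ n u i.succ
  have h₃ := pSet_succ n (u * Equiv.swap i.castSucc i.succ) i.castSucc
  rw [Fin.val_castSucc] at h₁ h₃
  rw [Fin.val_succ, h₁] at h₂
  rw [Equiv.Perm.mul_apply, Equiv.swap_apply_left, pSet_mul_swap n u i (j := i) (by omega)] at h₃
  rw [h₁, h₂, h₃]
  refine (tauA_insert_exchange n ?_ ?_ ?_).symm
  · simp [mem_pSet]
  · simp [mem_pSet]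
  · simp [Fin.ext_iff]

/-- All complete flags have the same monomial. -/
lemma prod_tauA_eq_prod_tauA_one (n : ℕ) (u : Equiv.Perm (Fin (n + 1))) :
    ∏ j ∈ Finset.range (n + 2), tauA n (pSet n u j) =
      ∏ j ∈ Finset.range (n + 2), tauA n (pSet n 1 j) := by
  have hu : u ∈ Submonoid.closure
      (Set.range fun i : Fin n => Equiv.swap i.castSucc i.succ) := by
    rw [Equiv.Perm.mclosure_swap_castSucc_succ]
    trivial
  induction hu using Submonoid.closure_induction_right with
  | one => rfl
  | mul_right x _ y hy ih =>
    obtain ⟨i, rfl⟩ := hy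
    rw [prod_tauA_mul_swap, ih]

/-- For every permutation `w` of `[n+1]`,
`(∏_{i ascent of w} τ_{w[i]}) · (∏_{i descent of w} τ_{w[i]}) = τ_{{1}} ⋯ τ_{{1,…,n}}` in `R_n`,
i.e. `⟨[Y^w][X_w], μ_X⟩ = 1`. -/
theorem typeA_transversal_point (n : ℕ) (hn : 1 ≤ n) (w : Equiv.Perm (Fin (n + 1))) :
    (∏ i ∈ ascents n w, tauA n (pSet n w i)) * (∏ i ∈ descents n w, tauA n (pSet n w i)) =
      ∏ i ∈ Finset.Icc 1 n, tauA n (Finset.univ.filter (fun x : Fin (n + 1) => (x : ℕ) < i)) := by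
  have h := Finset.prod_filter_not_mul_prod_filter (Finset.Icc 1 n)
    (fun i => pval n w (i + 1) < pval n w i) fun i => tauA n (pSet n w i)
  rw [ascents, descents, h, prod_tauA_Icc, prod_tauA_eq_prod_tauA_one, ← prod_tauA_Icc]
  refine Finset.prod_congr rfl fun i _ => congrArg _ ?_
  ext x
  rw [mem_pSet, Finset.mem_filter_univ]
  rfl
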